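/- Let A be a subgroup of a finitely generated group G, let φ : A → G be a monomorphism, and let G' be the HNN extension of G by means of φ, i.e. the group generated by G and an element y subject to the relations yay⁻¹ = φ(a) for all a ∈ A. If asdim G ≤ n, then asdim G' ≤ 2n + 1. -/

import Mathlib

/-- `AsdimOnLE dist A n` : the subset `A` of a space with distance function `dist` has
asymptotic dimension at most `n`. -/
def AsdimOnLE {X : Type*} (dist : X → X → ℝ) (A : Set X) (n : ℕ) : Prop :=
  ∀ d : ℝ, 0 < d → ∃ R : ℝ, ∃ 𝒰 : Fin (n + 1) → Set (Set X),
    (∀ i, ∀ U ∈ 𝒰 i, U ⊆ A) ∧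
    (∀ x ∈ A, ∃ i, ∃ U ∈ 𝒰 i, x ∈ U) ∧
    (∀ i, ∀ U ∈ 𝒰 i, ∀ V ∈ 𝒰 i, U ≠ V → ∀ x ∈ U, ∀ y ∈ V, d ≤ dist x y) ∧
    (∀ i, ∀ U ∈ 𝒰 i, ∀ x ∈ U, ∀ y ∈ U, dist x y ≤ R)

/-- The word norm of `x` with respect to the alphabet `S ∪ S⁻¹`. -/
noncomputable def wordNorm {G : Type*} [Group G] (S : Set G) (x : G) : ℕ :=
  sInf {n : ℕ | ∃ l : List G, l.length = n ∧ (∀ g ∈ l, g ∈ S ∨ g⁻¹ ∈ S) ∧ l.prod = x}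

/-- The left-invariant word metric `d_S(x,y) = ‖x⁻¹y‖_S`. -/
noncomputable def wordDist {G : Type*} [Group G] (S : Set G) (x y : G) : ℝ :=
  (wordNorm S (x⁻¹ * y) : ℝ)

open Relation

namespace AsdimHNN

/-- Monochromatic `d`-step inside `F`. -/
def Step {X : Type*} [PseudoMetricSpace X] {κ : Type*} (F : Set X) (c : X → κ) (d : ℝ)
    (x y : X) : Prop :=
  x ∈ F ∧ y ∈ F ∧ c x = c y ∧ dist x y < d

/-- Uniform asymptotic dimension bound for a family of subsets, in terms of colourings. -/
def UC {X : Type*} [PseudoMetricSpace X] {ι : Type*} (F : ι → Set X) (n : ℕ) : Prop :=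
  ∀ d : ℝ, 0 < d → ∃ R : ℝ, 0 ≤ R ∧ ∀ i, ∃ c : X → Fin (n + 1),
    ∀ x y, ReflTransGen (Step (F i) c d) x y → dist x y ≤ R

/-- From families to colourings. -/
theorem exists_coloring {X : Type*} (dst : X → X → ℝ) (n : ℕ)
    (h : AsdimOnLE dst Set.univ n) (d : ℝ) (hd : 0 < d) :
    ∃ R : ℝ, 0 ≤ R ∧ ∃ c : X → Fin (n + 1),
      ∀ x y, ReflTransGen (fun x y => c x = c y ∧ dst x y < d) x y → dst x y ≤ R := by
  obtain ⟨R, 𝒰, -, hcov, hdis, hbd⟩ := h d hd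
  choose c U hU hxU using fun x => hcov x (Set.mem_univ x)
  refine ⟨max R 0, le_max_right _ _, c, fun x y hxy => ?_⟩
  have key : c y = c x ∧ U y = U x := by
    induction hxy with
    | refl => exact ⟨rfl, rfl⟩
    | tail _ hst ih =>
      rename_i b w _
      refine ⟨hst.1 ▸ ih.1, ?_⟩
      rw [← ih.2]
      by_contra hne
      have := hdis (c b) (U b) (hU b) (U w) (hst.1 ▸ hU w) (Ne.symm hne) b (hxU b) w (hxU w)
      linarith [hst.2]
  exact (hbd _ _ (hU x) x (hxU x) y (key.2 ▸ hxU y)).trans (le_max_left _ _)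

/-- From colourings to families. -/
theorem asdim_of_coloring {X : Type*} [PseudoMetricSpace X] (n : ℕ)
    (h : ∀ d : ℝ, 0 < d → ∃ R : ℝ, ∃ c : X → Fin (n + 1),
      ∀ x y, ReflTransGen (Step Set.univ c d) x y → dist x y ≤ R) :
    AsdimOnLE (dist : X → X → ℝ) Set.univ n := by
  intro d hd
  obtain ⟨R, c, hc⟩ := h d hd
  have hsym : ∀ x y, ReflTransGen (Step Set.univ c d) x y →
      ReflTransGen (Step Set.univ c d) y x := by
    intro x y hxy
    induction hxy with
    | refl => exact .refl
    | tail _ hst ih =>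
      obtain ⟨h1, h2, h3, h4⟩ := hst
      exact ReflTransGen.head ⟨h2, h1, h3.symm, by rwa [dist_comm]⟩ ih
  have hcol : ∀ x y, ReflTransGen (Step Set.univ c d) x y → c x = c y := by
    intro x y hxy
    induction hxy with
    | refl => rfl
    | tail _ hst ih => exact ih.trans hst.2.2.1
  refine ⟨R, fun i => {U | ∃ x, c x = i ∧ U = {y | ReflTransGen (Step Set.univ c d) x y}},
    fun _ _ _ => Set.subset_univ _, ?_, ?_, ?_⟩
  · intro x _
    exact ⟨c x, _, ⟨x, rfl, rfl⟩, ReflTransGen.refl⟩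
  · rintro i _ ⟨a, ha, rfl⟩ _ ⟨b, hb, rfl⟩ hne x hx y hy
    by_contra hlt
    apply hne
    have hxy : ReflTransGen (Step Set.univ c d) x y := by
      refine ReflTransGen.single ⟨trivial, trivial, ?_, not_le.1 hlt⟩
      rw [← hcol _ _ hx, ← hcol _ _ hy, ha, hb]
    have hab : ReflTransGen (Step Set.univ c d) a b :=
      (ReflTransGen.trans hx hxy).trans (hsym _ _ hy)
    ext w
    exact ⟨fun hw => (hsym _ _ hab).trans hw, fun hw => hab.trans hw⟩
  · rintro i _ ⟨a, ha, rfl⟩ x hx y hy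
    exact hc _ _ ((hsym _ _ hx).trans hy)

/-- The infinite union theorem, uniform version. -/
theorem UC_union {X : Type*} [PseudoMetricSpace X] {ι κ : Type*} (F Y : ι → Set X) (e : X → κ)
    (n : ℕ) (hY : UC Y n) (hE : UC (fun k : κ => e ⁻¹' {k}) n)
    (hsep : ∀ i, ∀ x ∈ F i, ∀ y ∈ F i, x ∉ Y i → y ∉ Y i → e x ≠ e y →
      ∃ z ∈ Y i, dist x z ≤ dist x y) : UC F n := by
  classical
  intro d hd
  obtain ⟨R1, hR1, h1⟩ := hE d hd
  obtain ⟨R2, hR2, h2⟩ := hY (R1 + 4 * d + 1) (by linarith)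
  choose cE hcE using h1
  refine ⟨2 * R1 + 4 * d + R2, by linarith, fun i => ?_⟩
  obtain ⟨cY, hcY⟩ := h2 i
  let near : X → Prop := fun x => ∃ z ∈ Y i, dist x z ≤ d
  have hp : ∀ x, ∃ z, near x → z ∈ Y i ∧ dist x z ≤ d := by
    intro x
    by_cases hx : near x
    · obtain ⟨z, hz⟩ := hx
      exact ⟨z, fun _ => hz⟩
    · exact ⟨x, fun h => absurd h hx⟩
  choose p hp using hp
  let C : X → Fin (n + 1) := fun x => if near x then cY (p x) else cE (e x) x
  have Cn : ∀ x, near x → C x = cY (p x) := fun x hx => if_pos hx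
  have Cf : ∀ x, ¬ near x → C x = cE (e x) x := fun x hx => if_neg hx
  have hfar : ∀ x, ¬ near x → x ∉ Y i := fun x hx hxY => hx ⟨x, hxY, by simp [hd.le]⟩
  -- steps outside the neighbourhood
  have stepE : ∀ x y, ¬ near x → ¬ near y → Step (F i) C d x y →
      e y = e x ∧ Step (e ⁻¹' {e x}) (cE (e x)) d x y := by
    rintro x y hx hy ⟨hxF, hyF, hc, hlt⟩
    have he : e y = e x := by
      by_contra hne
      obtain ⟨z, hz, hxz⟩ := hsep i x hxF y hyF (hfar x hx) (hfar y hy) (Ne.symm hne)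
      exact hx ⟨z, hz, hxz.trans hlt.le⟩
    refine ⟨he, rfl, he, ?_, hlt⟩
    rw [Cf x hx, Cf y hy, he] at hc
    exact hc
  have stepY : ∀ x y, near x → near y → C x = C y → dist x y ≤ R1 + 2 * d →
      Step (Y i) cY (R1 + 4 * d + 1) (p x) (p y) := by
    intro x y hx hy hc hxy
    refine ⟨(hp x hx).1, (hp y hy).1, by rw [← Cn x hx, ← Cn y hy, hc], ?_⟩
    have a1 := (hp x hx).2
    have a2 := (hp y hy).2
    have a3 := dist_triangle (p x) x (p y)
    have a4 := dist_triangle x y (p y)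
    rw [dist_comm (p x) x] at a3
    linarith
  refine ⟨C, fun x0 x hx => ?_⟩
  have key : (¬ near x0 ∧ ¬ near x ∧ e x = e x0 ∧
        ReflTransGen (Step (e ⁻¹' {e x0}) (cE (e x0)) d) x0 x) ∨
      (∃ y1 y2, near y1 ∧ near y2 ∧ dist x0 y1 ≤ R1 + d ∧ C y2 = C x ∧
        ReflTransGen (Step (Y i) cY (R1 + 4 * d + 1)) (p y1) (p y2) ∧
        (x = y2 ∨ (¬ near x ∧ ∃ x', dist y2 x' ≤ d ∧ e x = e x' ∧
          ReflTransGen (Step (e ⁻¹' {e x'}) (cE (e x')) d) x' x))) := by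
    induction hx with
    | refl =>
      by_cases hn : near x0
      · exact Or.inr ⟨x0, x0, hn, hn, by rw [dist_self]; linarith, rfl, .refl, Or.inl rfl⟩
      · exact Or.inl ⟨hn, hn, rfl, .refl⟩
    | tail _ hst ih =>
      rename_i b w _
      by_cases hw : near w
      · right
        rcases ih with ⟨hx0, hb, heb, hch⟩ | ⟨y1, y2, hy1, hy2, hd1, hc, hch, hor⟩
        · refine ⟨w, w, hw, hw, ?_, rfl, .refl, Or.inl rfl⟩
          have := hcE _ _ _ hch
          have := dist_triangle x0 b w
          linarith [hst.2.2.2]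
        · have hdy : dist y2 b ≤ d + R1 := by
            rcases hor with rfl | ⟨_, x', hx', -, hch'⟩
            · rw [dist_self]; linarith
            · have := hcE _ _ _ hch'
              have := dist_triangle y2 x' b
              linarith
          refine ⟨y1, w, hy1, hw, hd1, rfl, hch.tail (stepY _ _ hy2 hw
            (hc.trans hst.2.2.1) ?_), Or.inl rfl⟩
          have := dist_triangle y2 b w
          linarith [hst.2.2.2]
      · rcases ih with ⟨hx0, hb, heb, hch⟩ | ⟨y1, y2, hy1, hy2, hd1, hc, hch, hor⟩
        · left
          obtain ⟨q1, q2⟩ := stepE b w hb hw hst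
          rw [heb] at q1 q2
          exact ⟨hx0, hw, q1, hch.tail q2⟩
        · right
          refine ⟨y1, y2, hy1, hy2, hd1, hc.trans hst.2.2.1, hch, Or.inr ⟨hw, ?_⟩⟩
          rcases hor with rfl | ⟨hb, x', hx', he', hch'⟩
          · exact ⟨w, hst.2.2.2.le, rfl, .refl⟩
          · obtain ⟨q1, q2⟩ := stepE b w hb hw hst
            rw [he'] at q1 q2
            exact ⟨x', hx', q1, hch'.tail q2⟩
  rcases key with ⟨-, -, -, hch⟩ | ⟨y1, y2, hy1, hy2, hd1, hc, hch, hor⟩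
  · have := hcE _ _ _ hch
    linarith
  · have hdy : dist y2 x ≤ d + R1 := by
      rcases hor with rfl | ⟨_, x', hx', -, hch'⟩
      · rw [dist_self]; linarith
      · have := hcE _ _ _ hch'
        have := dist_triangle y2 x' x
        linarith
    have a1 := hcY _ _ hch
    have a2 := (hp y1 hy1).2
    have a3 := (hp y2 hy2).2
    have a4 := dist_triangle x0 y1 x
    have a5 := dist_triangle y1 (p y1) x
    have a6 := dist_triangle (p y1) (p y2) x
    have a7 := dist_triangle (p y2) y2 x
    rw [dist_comm (p y2) y2] at a7
    linarith

/-- Points lying over descendants of `v` of depth at most `k`. -/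
def Desc {X α : Type*} (V : X → List α) (k : ℕ) (v : List α) : Set X :=
  {x | ∃ l : List α, l.length ≤ k ∧ V x = l ++ v}

theorem UC_desc {X α : Type*} [PseudoMetricSpace X] (V : X → List α) (n : ℕ)
    (hfib : UC (fun v : List α => V ⁻¹' {v}) n)
    (hsep : ∀ x y a u, (a :: u) <:+ V x → ¬ (a :: u) <:+ V y →
      ∃ z, V z = u ∧ dist x z ≤ dist x y) (k : ℕ) : UC (Desc V k) n := by
  induction k with
  | zero =>
    have : Desc V 0 = fun v : List α => V ⁻¹' {v} := by
      funext v
      ext x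
      simp [Desc]
    rwa [this]
  | succ k ih =>
    refine UC_union _ _ V n ih hfib ?_
    rintro v x ⟨l, hl, hx⟩ y ⟨l', hl', hy⟩ hxk hyk hne
    have e1 : l.length = k + 1 := by
      by_contra h
      exact hxk ⟨l, by omega, hx⟩
    have e2 : l'.length = k + 1 := by
      by_contra h
      exact hyk ⟨l', by omega, hy⟩
    cases l with
    | nil => simp at e1
    | cons a l =>
      obtain ⟨z, hz, hzd⟩ := hsep x y a (l ++ v) (by rw [hx]; exact List.suffix_rfl) (by
        intro hs
        apply hne
        rw [hx]
        refine hs.eq_of_length ?_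
        rw [hy]
        simp only [List.length_append, List.length_cons] at *
        omega)
      refine ⟨z, ⟨l, ?_, hz⟩, hzd⟩
      simp at e1
      omega

theorem asdim_tree {X α : Type*} [PseudoMetricSpace X] (V : X → List α) (n : ℕ)
    (hfib : UC (fun v : List α => V ⁻¹' {v}) n)
    (hlip : ∀ x y, ((V x).length : ℝ) ≤ (V y).length + dist x y)
    (hsep : ∀ x y a u, (a :: u) <:+ V x → ¬ (a :: u) <:+ V y →
      ∃ z, V z = u ∧ dist x z ≤ dist x y) :
    AsdimOnLE (dist : X → X → ℝ) Set.univ (2 * n + 1) := by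
  apply asdim_of_coloring
  intro d hd
  obtain ⟨r, hr⟩ := exists_nat_gt d
  have hr0 : 0 < r := by
    have : (0 : ℝ) < r := hd.trans hr
    exact_mod_cast this
  obtain ⟨R, hR, hc⟩ := UC_desc V n hfib hsep (2 * r) d hd
  choose c hc using hc
  let J : X → ℕ := fun x => (V x).length / r
  let s : X → List α := fun x => (V x).drop ((V x).length - (J x - 1) * r)
  have hs : ∀ x, s x <:+ V x := fun x => List.drop_suffix _ _
  have hJ1 : ∀ x, J x * r ≤ (V x).length := fun x => Nat.div_mul_le_self _ _
  have hJ2 : ∀ x, (V x).length < (J x + 1) * r := fun x =>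
    Nat.lt_mul_of_div_lt (Nat.lt_succ_self _) hr0
  have hJ3 : ∀ x, (J x - 1) * r ≤ (V x).length := fun x =>
    (Nat.mul_le_mul_right r (Nat.sub_le _ _)).trans (hJ1 x)
  have hslen : ∀ x, (s x).length = (J x - 1) * r := by
    intro x
    have := hJ3 x
    simp only [s, List.length_drop]
    omega
  have hmem : ∀ x, x ∈ Desc V (2 * r) (s x) := by
    intro x
    obtain ⟨l, hl⟩ := hs x
    refine ⟨l, ?_, hl.symm⟩
    have h1 := congrArg List.length hl
    rw [List.length_append, hslen] at h1
    have h2 := hJ2 x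
    have h3 : (J x + 1) * r ≤ (J x - 1) * r + 2 * r := by
      rw [← Nat.add_mul]
      exact Nat.mul_le_mul_right r (by omega)
    omega
  let par : X → Fin 2 := fun x => ⟨J x % 2, Nat.mod_lt _ two_pos⟩
  let eqv : Fin 2 × Fin (n + 1) ≃ Fin (2 * n + 1 + 1) :=
    finProdFinEquiv.trans (finCongr (by ring))
  have hnat : ∀ x y, dist x y < d → (V x).length < (V y).length + r := by
    intro x y hxy
    have := hlip x y
    have : ((V x).length : ℝ) < (V y).length + r := by linarith
    exact_mod_cast this
  have hlev : ∀ x y, par x = par y → dist x y < d → J x ≤ J y := by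
    intro x y hp hxy
    by_contra hlt
    have hp' : J x % 2 = J y % 2 := congrArg Fin.val hp
    have h2 : J y + 1 + 1 ≤ J x := by omega
    have h3 := Nat.mul_le_mul_right r h2
    rw [Nat.add_mul (J y + 1) 1 r] at h3
    have h4 := hnat x y hxy
    have h5 := hJ1 x
    have h6 := hJ2 y
    omega
  have hstep : ∀ x y, par x = par y → dist x y < d → s y = s x := by
    intro x y hp hxy
    have hJ : J x = J y := le_antisymm (hlev x y hp hxy)
      (hlev y x hp.symm (by rwa [dist_comm]))
    have hl : (s x).length = (s y).length := by rw [hslen, hslen, hJ]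
    by_cases hsx : s x <:+ V y
    · exact ((List.suffix_of_suffix_length_le hsx (hs y) hl.le).eq_of_length hl).symm
    · exfalso
      have hx := hs x
      have hlx := hslen x
      cases hsl : s x with
      | nil => exact hsx (by rw [hsl]; exact List.nil_suffix)
      | cons a u =>
        rw [hsl] at hsx hx hlx
        obtain ⟨z, hz, hzd⟩ := hsep x y a u hx hsx
        have h1 := hnat x z (hzd.trans_lt hxy)
        rw [hz] at h1
        have h2 := hJ1 x
        simp only [List.length_cons] at hlx
        have h3 : J x = (J x - 1) + 1 := by
          rcases Nat.eq_zero_or_pos (J x) with h | h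
          · rw [h] at hlx; simp at hlx
          · omega
        rw [h3, Nat.add_mul] at h2
        omega
  refine ⟨R, fun x => eqv (par x, c (s x) x), fun x y hxy => ?_⟩
  have key : s y = s x ∧ ReflTransGen (Step (Desc V (2 * r) (s x)) (c (s x)) d) x y := by
    induction hxy with
    | refl => exact ⟨rfl, .refl⟩
    | tail _ hst ih =>
      rename_i b w _
      obtain ⟨ih1, ih2⟩ := ih
      have hcol := eqv.injective hst.2.2.1
      rw [Prod.mk.injEq] at hcol
      have h1 := hstep b w hcol.1 hst.2.2.2
      have h2 : s w = s x := h1.trans ih1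
      refine ⟨h2, ih2.tail ⟨ih1 ▸ hmem b, h2 ▸ hmem w, ?_, hst.2.2.2⟩⟩
      have h3 := hcol.2
      rw [h2, ih1] at h3
      exact h3
  exact hc _ _ _ key.2

/-! ### Word norms -/

section Word

variable {G : Type*} [Group G]

theorem wordNorm_le (S : Set G) (l : List G) (hl : ∀ g ∈ l, g ∈ S ∨ g⁻¹ ∈ S) :
    wordNorm S l.prod ≤ l.length :=
  Nat.sInf_le ⟨l, rfl, hl, rfl⟩

theorem exists_word (S : Set G) (hS : Subgroup.closure S = ⊤) (x : G) :
    ∃ l : List G, l.length = wordNorm S x ∧ (∀ g ∈ l, g ∈ S ∨ g⁻¹ ∈ S) ∧ l.prod = x := by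
  have hx : x ∈ Subgroup.closure S := hS ▸ Subgroup.mem_top x
  rw [← Subgroup.mem_toSubmonoid, Subgroup.closure_toSubmonoid] at hx
  obtain ⟨l, hl, hp⟩ := Submonoid.exists_list_of_mem_closure hx
  exact Nat.sInf_mem (s := {n : ℕ | ∃ l : List G, l.length = n ∧
    (∀ g ∈ l, g ∈ S ∨ g⁻¹ ∈ S) ∧ l.prod = x}) ⟨l.length, l, rfl, hl, hp⟩

theorem wordNorm_one (S : Set G) : wordNorm S (1 : G) = 0 := by
  have := wordNorm_le S [] (by simp)
  simpa using this

theorem wordNorm_mul (S : Set G) (hS : Subgroup.closure S = ⊤) (x y : G) :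
    wordNorm S (x * y) ≤ wordNorm S x + wordNorm S y := by
  obtain ⟨l, h1, h2, rfl⟩ := exists_word S hS x
  obtain ⟨m, h3, h4, rfl⟩ := exists_word S hS y
  rw [← h1, ← h3, ← List.prod_append, ← List.length_append]
  apply wordNorm_le
  intro g hg
  rcases List.mem_append.1 hg with h | h
  · exact h2 g h
  · exact h4 g h

theorem wordNorm_inv_le (S : Set G) (hS : Subgroup.closure S = ⊤) (x : G) :
    wordNorm S x⁻¹ ≤ wordNorm S x := by
  obtain ⟨l, h1, h2, rfl⟩ := exists_word S hS x
  rw [← h1, List.prod_inv_reverse]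
  refine (wordNorm_le S _ ?_).trans (by simp)
  intro g hg
  simp only [List.mem_reverse, List.mem_map] at hg
  obtain ⟨a, ha, rfl⟩ := hg
  rw [inv_inv]
  exact (h2 a ha).symm

theorem wordNorm_inv (S : Set G) (hS : Subgroup.closure S = ⊤) (x : G) :
    wordNorm S x⁻¹ = wordNorm S x :=
  le_antisymm (wordNorm_inv_le S hS x) (by simpa using wordNorm_inv_le S hS x⁻¹)

/-- The word metric as a pseudometric. -/
noncomputable abbrev wordMetric (S : Set G) (hS : Subgroup.closure S = ⊤) :
    PseudoMetricSpace G where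
  dist := wordDist S
  dist_self x := by simp [wordDist, wordNorm_one]
  dist_comm x y := by
    have : x⁻¹ * y = (y⁻¹ * x)⁻¹ := by group
    simp only [wordDist]
    rw [this, wordNorm_inv S hS]
  dist_triangle x y z := by
    have : x⁻¹ * z = (x⁻¹ * y) * (y⁻¹ * z) := by group
    simp only [wordDist]
    rw [this]
    exact_mod_cast wordNorm_mul S hS _ _

theorem finite_ball (S : Set G) (hS : Subgroup.closure S = ⊤) (hf : S.Finite) (m : ℕ) :
    {x : G | wordNorm S x ≤ m}.Finite := by
  have hT : (S ∪ S⁻¹).Finite := hf.union hf.inv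
  have := hT.to_subtype
  have hfin := (List.finite_length_le (↥(S ∪ S⁻¹)) m).image
    (fun l => (l.map Subtype.val).prod)
  refine hfin.subset ?_
  intro x hx
  obtain ⟨l, h1, h2, rfl⟩ := exists_word S hS x
  have hl : ∀ g ∈ l, g ∈ S ∪ S⁻¹ := fun g hg => by simpa using h2 g hg
  lift l to List ↥(S ∪ S⁻¹) using hl
  refine ⟨l, ?_, rfl⟩
  simp only [List.length_map] at h1
  simpa [h1] using hx

end Word

/-! ### The HNN extension -/

section HNN

open HNNExtension HNNExtension.NormalWord

variable {G : Type*} [Group G] {A B : Subgroup G} {φ : A ≃* B}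

/-- The vertex of the Bass-Serre tree, as a list of letters of a normal form. -/
noncomputable def vert (d : TransversalPair G A B) (x : HNNExtension G A B φ) : List (ℤˣ × G) :=
  (x⁻¹ • (empty : NormalWord d)).toList

theorem vert_mul_of (d : TransversalPair G A B) (x : HNNExtension G A B φ) (g : G) :
    vert d (x * of g) = vert d x := by
  unfold vert
  rw [mul_inv_rev, mul_smul, ← map_inv, of_smul_eq_smul, group_smul_toList]

theorem vert_mul_t (d : TransversalPair G A B) (x : HNNExtension G A B φ) (u : ℤˣ) :
    (∃ a, vert d x = a :: vert d (x * t ^ (u : ℤ))) ∨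
    (∃ a, vert d (x * t ^ (u : ℤ)) = a :: vert d x) := by
  unfold vert
  have : (x * t ^ (u : ℤ))⁻¹ = t ^ ((-u : ℤˣ) : ℤ) * x⁻¹ := by
    simp [mul_inv_rev]
  rw [this, mul_smul, t_pow_smul_eq_unitsSMul]
  generalize x⁻¹ • (empty : NormalWord d) = w
  by_cases hc : Cancels (-u) w
  · left
    unfold unitsSMul
    rw [dif_pos hc]
    cases w using consRecOn with
    | ofGroup => simp [Cancels] at hc
    | cons g u' w h1 h2 ih =>
      exact ⟨(u', w.head), by simp [unitsSMulWithCancel]⟩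
  · right
    unfold unitsSMul
    rw [dif_neg hc]
    exact ⟨_, rfl⟩

theorem exists_of_vert_eq (d : TransversalPair G A B) (x y : HNNExtension G A B φ)
    (h : vert d x = vert d y) : ∃ g : G, x⁻¹ * y = of g := by
  have hx := prod_smul φ x⁻¹ (empty : NormalWord d)
  have hy := prod_smul φ y⁻¹ (empty : NormalWord d)
  rw [prod_empty, mul_one] at hx hy
  unfold vert at h
  rw [ReducedWord.prod] at hx hy
  rw [h] at hx
  generalize (y⁻¹ • (empty : NormalWord d)) = w at *
  generalize (x⁻¹ • (empty : NormalWord d)) = w' at *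
  refine ⟨w'.head * w.head⁻¹, ?_⟩
  rw [← hx, eq_comm, ← inv_inv y, ← hy]
  simp

variable (φ) in
/-- The generating set. -/
def gens (S : Set G) : Set (HNNExtension G A B φ) :=
  (of : G →* HNNExtension G A B φ) '' S ∪ {t, t⁻¹}

theorem closure_gens (S : Set G) (hS : Subgroup.closure S = ⊤) :
    Subgroup.closure (gens φ S) = ⊤ := by
  rw [Subgroup.eq_top_iff']
  intro x
  induction x using HNNExtension.induction_on with
  | of g =>
    have hg : g ∈ Subgroup.closure S := hS ▸ Subgroup.mem_top g
    have h1 := Subgroup.mem_map_of_mem (of : G →* HNNExtension G A B φ) hg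
    rw [MonoidHom.map_closure] at h1
    exact Subgroup.closure_mono Set.subset_union_left h1
  | t => exact Subgroup.subset_closure (Or.inr (Or.inl rfl))
  | mul x y hx hy => exact mul_mem hx hy
  | inv x hx => exact inv_mem hx

theorem vert_step (d : TransversalPair G A B) (S : Set G) (x g : HNNExtension G A B φ)
    (hg : g ∈ gens φ S ∨ g⁻¹ ∈ gens φ S) :
    vert d (x * g) = vert d x ∨ (∃ a, vert d x = a :: vert d (x * g)) ∨
    (∃ a, vert d (x * g) = a :: vert d x) := by
  have key : (∃ s : G, g = of s) ∨ (∃ u : ℤˣ, g = t ^ (u : ℤ)) := by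
    rcases hg with (⟨s, -, rfl⟩ | h | h) | (⟨s, -, h⟩ | h | h)
    · exact Or.inl ⟨s, rfl⟩
    · exact Or.inr ⟨1, by simpa using h⟩
    · exact Or.inr ⟨-1, by simpa using h⟩
    · exact Or.inl ⟨s⁻¹, by rw [map_inv, h, inv_inv]⟩
    · exact Or.inr ⟨-1, by simpa using (inv_eq_iff_eq_inv.1 h)⟩
    · exact Or.inr ⟨1, by simpa using h⟩
  rcases key with ⟨s, rfl⟩ | ⟨u, rfl⟩
  · exact Or.inl (vert_mul_of d x s)
  · exact Or.inr (vert_mul_t d x u)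

theorem vert_lip (d : TransversalPair G A B) (S : Set G) (l : List (HNNExtension G A B φ))
    (hl : ∀ g ∈ l, g ∈ gens φ S ∨ g⁻¹ ∈ gens φ S) (x : HNNExtension G A B φ) :
    (vert d x).length ≤ (vert d (x * l.prod)).length + l.length := by
  induction l generalizing x with
  | nil => simp
  | cons g l ih =>
    have h1 := ih (fun g hg => hl g (List.mem_cons_of_mem _ hg)) (x * g)
    rw [List.prod_cons, ← mul_assoc, List.length_cons]
    rcases vert_step d S x g (hl g List.mem_cons_self) with h | ⟨a, h⟩ | ⟨a, h⟩
    · rw [h] at h1; omega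
    · have := congrArg List.length h
      simp only [List.length_cons] at this
      omega
    · have := congrArg List.length h
      simp only [List.length_cons] at this
      omega

theorem vert_sep (d : TransversalPair G A B) (S : Set G) (hS : Subgroup.closure S = ⊤)
    (l : List (HNNExtension G A B φ))
    (hl : ∀ g ∈ l, g ∈ gens φ S ∨ g⁻¹ ∈ gens φ S) (x : HNNExtension G A B φ)
    (a : ℤˣ × G) (u : List (ℤˣ × G)) (hx : (a :: u) <:+ vert d x)
    (hy : ¬ (a :: u) <:+ vert d (x * l.prod)) :
    ∃ z, vert d z = u ∧ wordNorm (gens φ S) (x⁻¹ * z) ≤ l.length := by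
  induction l generalizing x with
  | nil => simp at hy; exact absurd hx hy
  | cons g l ih =>
    rw [List.prod_cons, ← mul_assoc] at hy
    have hg : wordNorm (gens φ S) g ≤ 1 := by
      have := wordNorm_le (gens φ S) [g] (by simpa using hl g List.mem_cons_self)
      simpa using this
    by_cases hxg : (a :: u) <:+ vert d (x * g)
    · obtain ⟨z, hz, hzn⟩ := ih (fun g hg => hl g (List.mem_cons_of_mem _ hg)) (x * g) hxg hy
      refine ⟨z, hz, ?_⟩
      have e : x⁻¹ * z = g * ((x * g)⁻¹ * z) := by group
      rw [e, List.length_cons]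
      have := wordNorm_mul (gens φ S) (closure_gens S hS) g ((x * g)⁻¹ * z)
      omega
    · refine ⟨x * g, ?_, ?_⟩
      · rcases vert_step d S x g (hl g List.mem_cons_self) with h | ⟨b, h⟩ | ⟨b, h⟩
        · rw [h] at hxg; exact absurd hx hxg
        · rw [h, List.suffix_cons_iff] at hx
          rcases hx with hx | hx
          · exact (List.cons.inj hx).2.symm
          · exact absurd hx hxg
        · rw [h] at hxg
          exact absurd (hx.trans (List.suffix_cons _ _)) hxg
      · rw [inv_mul_cancel_left, List.length_cons]
        omega

theorem wordNorm_of_le (S : Set G) (hS : Subgroup.closure S = ⊤) (g : G) :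
    wordNorm (gens φ S) (of g) ≤ wordNorm S g := by
  obtain ⟨l, h1, h2, rfl⟩ := exists_word S hS g
  rw [← h1, map_list_prod]
  refine (wordNorm_le _ _ ?_).trans (by simp)
  intro x hx
  obtain ⟨a, ha, rfl⟩ := List.mem_map.1 hx
  rcases h2 a ha with h | h
  · exact Or.inl (Or.inl ⟨a, h, rfl⟩)
  · exact Or.inr (Or.inl ⟨a⁻¹, h, by simp⟩)

theorem exists_wordNorm_bound (S : Set G) (hS : Subgroup.closure S = ⊤) (hf : S.Finite) (m : ℕ) :
    ∃ N : ℕ, ∀ g : G, wordNorm (gens φ S) (of g) ≤ m → wordNorm S g ≤ N := by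
  have hfin : (gens φ S).Finite := (hf.image _).union (by simp)
  have h1 := finite_ball (gens φ S) (closure_gens S hS) hfin m
  have h2 := h1.preimage (f := (of : G → HNNExtension G A B φ)) (of_injective (φ := φ)).injOn
  obtain ⟨N, hN⟩ := (h2.image (wordNorm S)).bddAbove
  exact ⟨N, fun g hg => hN ⟨g, hg, rfl⟩⟩

end HNN

end AsdimHNN

open AsdimHNN HNNExtension.NormalWord

/-- **Theorem 7.** Let `φ : A → G` be a monomorphism of a subgroup `A` of a finitely
generated group `G` with `asdim G ≤ n` (realized in Mathlib as a group isomorphism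
`φ : A ≃* B` onto its image `B = φ(A) ≤ G`), and let `G'` be the HNN extension of `G`
by means of `φ`, with the word metric from `S' = S ∪ {y, y⁻¹}`.
Then `asdim G' ≤ 2n + 1`. -/
theorem asdim_HNN_le {G : Type*} [Group G] (A B : Subgroup G) (φ : A ≃* B)
    (S : Finset G) (hS : Subgroup.closure (S : Set G) = ⊤) (n : ℕ)
    (hG : AsdimOnLE (wordDist (S : Set G)) (Set.univ : Set G) n) :
    AsdimOnLE
      (wordDist ((HNNExtension.of : G →* HNNExtension G A B φ) '' (S : Set G) ∪
        {HNNExtension.t, (HNNExtension.t)⁻¹}))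
      (Set.univ : Set (HNNExtension G A B φ)) (2 * n + 1) := by
  classical
  have hfinS : (S : Set G).Finite := S.finite_toSet
  have hcl := closure_gens (φ := φ) (S : Set G) hS
  obtain ⟨d⟩ := TransversalPair.nonempty G A B
  let _ := wordMetric (gens φ (S : Set G)) hcl
  have hdist : ∀ x y : HNNExtension G A B φ,
      dist x y = (wordNorm (gens φ (S : Set G)) (x⁻¹ * y) : ℝ) := fun _ _ => rfl
  change AsdimOnLE (dist : HNNExtension G A B φ → HNNExtension G A B φ → ℝ) Set.univ (2 * n + 1)
  refine asdim_tree (vert d) n ?_ ?_ ?_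
  · intro r hr
    obtain ⟨m, hm⟩ := exists_nat_gt r
    obtain ⟨N, hN⟩ := exists_wordNorm_bound (φ := φ) (S : Set G) hS hfinS m
    obtain ⟨R, hR, c, hc⟩ := exists_coloring _ n hG (N + 1) (by positivity)
    refine ⟨R, hR, fun v => ?_⟩
    by_cases hv : ∃ g : HNNExtension G A B φ, vert d g = v
    · obtain ⟨g, hg⟩ := hv
      have hq : ∀ x : HNNExtension G A B φ, ∃ q : G, vert d x = v → g⁻¹ * x = HNNExtension.of q := by
        intro x
        by_cases hx : vert d x = v
        · obtain ⟨q, hq⟩ := exists_of_vert_eq d g x (hg.trans hx.symm)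
          exact ⟨q, fun _ => hq⟩
        · exact ⟨1, fun h => absurd h hx⟩
      choose q hq using hq
      have hxy : ∀ x y, vert d x = v → vert d y = v → x⁻¹ * y = HNNExtension.of ((q x)⁻¹ * q y) := by
        intro x y hx hy
        rw [map_mul, map_inv, ← hq x hx, ← hq y hy]
        group
      refine ⟨fun x => c (q x), fun x y hch => ?_⟩
      have key : x = y ∨ (vert d x = v ∧ vert d y = v ∧
          Relation.ReflTransGen (fun a b => c a = c b ∧ wordDist (S : Set G) a b < N + 1)
            (q x) (q y)) := by
        induction hch with
        | refl => exact Or.inl rfl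
        | tail _ hst ih =>
          rename_i b w _
          obtain ⟨hb, hw, hcol, hlt⟩ := hst
          have hb' : vert d b = v := hb
          have hw' : vert d w = v := hw
          have hs : c (q b) = c (q w) ∧ wordDist (S : Set G) (q b) (q w) < N + 1 := by
            refine ⟨hcol, ?_⟩
            rw [hdist, hxy b w hb' hw'] at hlt
            have h1 : wordNorm (gens φ (S : Set G)) (HNNExtension.of ((q b)⁻¹ * q w)) ≤ m := by
              have := hlt.trans hm
              exact_mod_cast this.le
            have h2 := hN _ h1
            have h3 : (wordNorm (S : Set G) ((q b)⁻¹ * q w) : ℝ) ≤ N := by exact_mod_cast h2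
            unfold wordDist
            linarith
          right
          rcases ih with rfl | ⟨h1, -, h3⟩
          · exact ⟨hb', hw', .single hs⟩
          · exact ⟨h1, hw', h3.tail hs⟩
      rcases key with rfl | ⟨hx, hy, hch'⟩
      · rw [dist_self]; exact hR
      · refine le_trans ?_ (hc _ _ hch')
        rw [hdist, hxy x y hx hy]
        unfold wordDist
        exact_mod_cast wordNorm_of_le (φ := φ) (S : Set G) hS _
    · refine ⟨fun _ => 0, fun x y hch => ?_⟩
      have : x = y := by
        induction hch with
        | refl => rfl
        | tail _ hst ih => exact absurd ⟨_, hst.1⟩ hv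
      rw [this, dist_self]; exact hR
  · intro x y
    obtain ⟨l, h1, h2, h3⟩ := exists_word _ hcl (x⁻¹ * y)
    have := vert_lip d (S : Set G) l h2 x
    rw [h3, mul_inv_cancel_left, h1] at this
    rw [hdist]
    exact_mod_cast this
  · intro x y a u hx hy
    obtain ⟨l, h1, h2, h3⟩ := exists_word _ hcl (x⁻¹ * y)
    obtain ⟨z, hz, hzn⟩ := vert_sep d (S : Set G) hS l h2 x a u hx
      (by rwa [h3, mul_inv_cancel_left])
    refine ⟨z, hz, ?_⟩
    rw [hdist, hdist]
    rw [h1] at hzn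
    exact_mod_cast hzn
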